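/- Let u solve u_t = (J*u) - u on ℝ (Cauchy problem) with initial data u₀ that is antisymmetric with respect to a point x̄ (u₀(2x̄ - x) = -u₀(x)) and satisfies u₀(x) ≥ 0 for x ≥ x̄. Then for all t > 0, u(·,t) is antisymmetric with respect to x̄ and u(x,t) ≥ 0 for x ≥ x̄. -/

import Mathlib

open MeasureTheory Set

/-- An even function which is nonincreasing on `[0, ∞)` is nonincreasing in `|z|`. -/
theorem le_of_abs_le_abs_of_even_of_antitoneOn {k : ℝ → ℝ} (heven : ∀ z, k (-z) = k z)
    (hanti : AntitoneOn k (Ici 0)) {a b : ℝ} (hab : |a| ≤ |b|) : k b ≤ k a := by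
  have habs : ∀ z, k |z| = k z := fun z => by
    rcases abs_choice z with h | h <;> simp [h, heven]
  rw [← habs a, ← habs b]
  exact hanti (abs_nonneg a) (abs_nonneg b) hab

/-- Convolution with an even kernel preserves antisymmetry about a point. -/
theorem integral_even_kernel_mul_reflect {k v : ℝ → ℝ} {c : ℝ} (heven : ∀ z, k (-z) = k z)
    (hv : ∀ x, v (2 * c - x) = -v x) (x : ℝ) :
    ∫ y, k (2 * c - x - y) * v y = -∫ y, k (x - y) * v y := by
  rw [← integral_sub_left_eq_self (fun y => k (2 * c - x - y) * v y) volume (2 * c),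
    ← integral_neg]
  congr 1 with y
  rw [hv, ← heven (x - y), show 2 * c - x - (2 * c - y) = -(x - y) by ring, mul_neg]

/-- Convolving a function antisymmetric about `c` and nonnegative on `[c, ∞)` with an even kernel
nonincreasing on `[0, ∞)` gives a function which is nonnegative on `[c, ∞)`. -/
theorem integral_even_antitone_kernel_mul_nonneg {k v : ℝ → ℝ} {c : ℝ}
    (heven : ∀ z, k (-z) = k z) (hk : AntitoneOn k (Ici 0))
    (hv : ∀ x, v (2 * c - x) = -v x) (hpos : ∀ x, c ≤ x → 0 ≤ v x) {x : ℝ} (hx : c ≤ x) :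
    0 ≤ ∫ y, k (x - y) * v y := by
  by_cases hint : Integrable fun y => k (x - y) * v y
  · have hrefl := integral_sub_left_eq_self (fun y => k (x - y) * v y) volume (2 * c)
    have hsum := integral_add hint (hint.comp_sub_left (2 * c))
    have hnonneg : 0 ≤ ∫ y, (k (x - y) * v y + k (x - (2 * c - y)) * v (2 * c - y)) := by
      refine integral_nonneg fun y => ?_
      have hfactor : k (x - y) * v y + k (x - (2 * c - y)) * v (2 * c - y)
          = (k (x - y) - k (x - (2 * c - y))) * v y := by
        rw [hv]; ring
      simp only [Pi.zero_apply, hfactor]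
      rcases le_total c y with hy | hy
      · refine mul_nonneg (sub_nonneg.2 ?_) (hpos y hy)
        refine le_of_abs_le_abs_of_even_of_antitoneOn heven hk (sq_le_sq.1 ?_)
        nlinarith [mul_nonneg (sub_nonneg.2 hx) (sub_nonneg.2 hy)]
      · have hvy : v y ≤ 0 := by
          have := hpos (2 * c - y) (by linarith)
          rw [hv] at this
          linarith
        refine mul_nonneg_of_nonpos_of_nonpos (sub_nonpos.2 ?_) hvy
        refine le_of_abs_le_abs_of_even_of_antitoneOn heven hk (sq_le_sq.1 ?_)
        nlinarith [mul_nonneg (sub_nonneg.2 hx) (sub_nonneg.2 hy)]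
    linarith
  · rw [integral_undef hint]

theorem antisymmetry_preserved
    (d : ℝ) (hd : 0 < d)
    (ω : ℝ → ℝ → ℝ)
    (hωe : ∀ (z t : ℝ), 0 < t → ω (-z) t = ω z t)
    (hωa : ∀ t : ℝ, 0 < t → AntitoneOn (fun z => ω z t) (Ici 0))
    (hω0 : ∀ (z t : ℝ), 0 < t → 0 ≤ ω z t)
    (hωi : ∀ t : ℝ, 0 < t → Integrable fun z => ω z t)
    (u₀ : ℝ → ℝ) (hu₀i : Integrable u₀) (hu₀b : ∃ C, ∀ x, |u₀ x| ≤ C)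
    (xb : ℝ)
    (hanti : ∀ x : ℝ, u₀ (2 * xb - x) = -u₀ x)
    (hpos : ∀ x : ℝ, xb ≤ x → 0 ≤ u₀ x)
    (u : ℝ → ℝ → ℝ)
    (hu : ∀ (x t : ℝ), 0 < t →
      u x t = Real.exp (-t) * u₀ x + ∫ y, ω (x - y) t * u₀ y) :
    ∀ t : ℝ, 0 < t →
      (∀ x : ℝ, u (2 * xb - x) t = -u x t) ∧ (∀ x : ℝ, xb ≤ x → 0 ≤ u x t) := by
  intro t ht
  have heven : ∀ z, ω (-z) t = ω z t := fun z => hωe z t ht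
  refine ⟨fun x => ?_, fun x hx => ?_⟩
  · rw [hu _ t ht, hu x t ht, hanti,
      integral_even_kernel_mul_reflect (k := fun z => ω z t) heven hanti x]
    ring
  · rw [hu x t ht]
    exact add_nonneg (mul_nonneg (Real.exp_pos _).le (hpos x hx))
      (integral_even_antitone_kernel_mul_nonneg (k := fun z => ω z t) heven (hωa t ht)
        hanti hpos hx)
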